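/- (ℓ2 upper bound) In the bow tie setting, assume E3∩π3 is nonempty and that for all i ∈ {1,2,3} and all γ ∈ F_2^n with γ ∉ V^⊥ one has |(Ê_i)_{a_i}(γ)| ≤ δ, where 0 ≤ δ ≤ 1. Write μ_i = μ_{π_i}(E_i). Then (1/|E3∩π3|^2) Σ_{z ∈ E3∩π3} Σ_{z' ∈ E3∩π3} #{ e edge of G : 1_z(e) = 1 and 1_{z'}(e) = 1 } ≤ |V|^2·( μ1^3·μ2^3·μ3 + 10·√δ ). -/

import Mathlib

/-- Vectors of length `n` over `F_2`. -/
abbrev Vec (n : ℕ) := Fin n → ZMod 2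

/-- Inner product `γ · v = Σ_j γ_j v_j` (mod 2). -/
def dot {n : ℕ} (γ v : Vec n) : ZMod 2 := ∑ j, γ j * v j

/-- `(-1)^t` for a bit `t`. -/
def sgn (t : ZMod 2) : ℝ := if t = 0 then 1 else -1

/-- The Fourier coefficient of (the indicator of) the set `S` on the coset `a + V`:
`Ŝ_a(γ) = (1/|V|) Σ_{v ∈ V} 1_S(a + v) (-1)^{γ · v}`. -/
noncomputable def fourierOn {n : ℕ} (V : Submodule (ZMod 2) (Vec n))
    (S : Set (Vec n)) (a γ : Vec n) : ℝ :=
  (∑ v : Vec n, Set.indicator (V : Set (Vec n))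
      (fun v => Set.indicator S (fun _ => (1 : ℝ)) (a + v) * sgn (dot γ v)) v)
    / (Nat.card V : ℝ)

/-- The coset `a + V`. -/
def coset {n : ℕ} (a : Vec n) (V : Submodule (ZMod 2) (Vec n)) : Set (Vec n) :=
  {x | x - a ∈ V}

/-- `μ_π(S) = |S ∩ π| / |V|`: the measure of `S` under the uniform distribution on the
coset `π` of the subspace `V`. -/
noncomputable def muOn {n : ℕ} (V : Submodule (ZMod 2) (Vec n)) (π S : Set (Vec n)) : ℝ :=
  (Nat.card (S ∩ π : Set (Vec n)) : ℝ) / (Nat.card V : ℝ)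

/-- An edge of the graph `G`: a pair `(x, y)` with `x ∈ E1 ∩ π1`, `y ∈ E2 ∩ π2` and
`x + y ∈ E3 ∩ π3`, where `π_i = a_i + V`. -/
def isEdge {n : ℕ} (V : Submodule (ZMod 2) (Vec n)) (a1 a2 a3 : Vec n)
    (E1 E2 E3 : Set (Vec n)) (x y : Vec n) : Prop :=
  x ∈ E1 ∩ coset a1 V ∧ y ∈ E2 ∩ coset a2 V ∧ x + y ∈ E3 ∩ coset a3 V

/-- `1_z(e) = 1` for an edge `e = (x, y)`: `x + z ∈ E2 ∩ π2`, `y + z ∈ E1 ∩ π1` and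
`y ≠ x + z`. -/
def oneZ {n : ℕ} (V : Submodule (ZMod 2) (Vec n)) (a1 a2 : Vec n)
    (E1 E2 : Set (Vec n)) (z : Vec n) (e : Vec n × Vec n) : Prop :=
  e.1 + z ∈ E2 ∩ coset a2 V ∧ e.2 + z ∈ E1 ∩ coset a1 V ∧ e.2 ≠ e.1 + z

open Finset in
lemma sgn_dot_add {n : ℕ} (γ x y : Vec n) :
    sgn (dot γ (x + y)) = sgn (dot γ x) * sgn (dot γ y) := by
  have h : ∀ s t : ZMod 2, sgn (s + t) = sgn s * sgn t := by
    have hz : ∀ s : ZMod 2, s = 0 ∨ s = 1 := by decide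
    have h11 : (1 : ZMod 2) + 1 = 0 := by decide
    intro s t
    rcases hz s with rfl | rfl <;> rcases hz t with rfl | rfl <;> simp [sgn, h11]
  rw [← h]
  congr 1
  simp [dot, mul_add, sum_add_distrib]

lemma dot_comm {n : ℕ} (γ x : Vec n) : dot γ x = dot x γ := by
  simp [dot, mul_comm]

lemma sgn_eq_neg_one {t : ZMod 2} (h : t ≠ 0) : sgn t = -1 := by simp [sgn, h]

lemma sgn_mul_self (t : ZMod 2) : sgn t * sgn t = 1 := by
  unfold sgn; split_ifs <;> norm_num

lemma abs_sgn (t : ZMod 2) : |sgn t| = 1 := by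
  unfold sgn; split_ifs <;> norm_num

lemma sum_sgn_dot {n : ℕ} (v : Vec n) :
    ∑ γ : Vec n, sgn (dot γ v) = if v = 0 then (2 : ℝ) ^ n else 0 := by
  split_ifs with h
  · subst h
    simp [dot, sgn, ZMod.card]
  · obtain ⟨j, hj⟩ := Function.ne_iff.mp h
    have hd : dot (Pi.single j 1) v ≠ 0 := by
      simpa [dot, Pi.single_apply] using hj
    have := Equiv.sum_comp (Equiv.addRight (Pi.single j 1 : Vec n)) (fun γ => sgn (dot γ v))
    simp only [Equiv.coe_addRight] at this
    simp_rw [dot_comm _ v, sgn_dot_add, dot_comm v, sgn_eq_neg_one hd] at this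
    rw [← Finset.sum_mul] at this
    linarith

/-- The unnormalised Fourier transform on `F_2^n`. -/
noncomputable def walsh {n : ℕ} (k : Vec n → ℝ) (γ : Vec n) : ℝ :=
  ∑ x, k x * sgn (dot γ x)

lemma sum_walsh_sq {n : ℕ} (k : Vec n → ℝ) :
    ∑ γ, walsh k γ ^ 2 = 2 ^ n * ∑ x, k x ^ 2 := by
  have h1 : ∀ γ, walsh k γ ^ 2 = ∑ x, ∑ y, k x * k y * sgn (dot γ (x + y)) := by
    intro γ
    rw [walsh, sq, Finset.sum_mul_sum]
    refine Finset.sum_congr rfl fun x _ => Finset.sum_congr rfl fun y _ => ?_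
    rw [sgn_dot_add]; ring
  simp_rw [h1]
  rw [Finset.sum_comm, Finset.mul_sum]
  refine Finset.sum_congr rfl fun x _ => ?_
  rw [Finset.sum_comm]
  simp_rw [← Finset.mul_sum, sum_sgn_dot]
  rw [Finset.sum_eq_single x]
  · simp [ZModModule.add_self]; ring
  · intro y _ hy
    rw [if_neg, mul_zero]
    intro h
    exact hy (by rw [← ZModModule.sub_eq_add, sub_eq_zero] at h; exact h.symm)
  · simp

lemma walsh_conv {n : ℕ} (k f : Vec n → ℝ) (γ : Vec n) :
    walsh (fun v => ∑ w, k w * f (v + w)) γ = walsh k γ * walsh f γ := by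
  simp only [walsh, Finset.sum_mul]
  rw [Finset.sum_comm]
  refine Finset.sum_congr rfl fun w _ => ?_
  rw [Finset.mul_sum, ← Equiv.sum_comp (Equiv.addRight w)
    (fun x => k w * sgn (dot γ w) * (f x * sgn (dot γ x)))]
  refine Finset.sum_congr rfl fun v _ => ?_
  simp only [Equiv.coe_addRight, sgn_dot_add]
  linear_combination (-(k w * f (v + w) * sgn (dot γ v))) * sgn_mul_self (dot γ w)

lemma sum_conv_sq_le {n : ℕ} (k f : Vec n → ℝ) (M : ℝ) (hf : ∀ γ, |walsh f γ| ≤ M) :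
    ∑ v, (∑ w, k w * f (v + w)) ^ 2 ≤ M ^ 2 * ∑ w, k w ^ 2 := by
  have h1 := sum_walsh_sq (fun v => ∑ w, k w * f (v + w))
  have h2 := sum_walsh_sq k
  have h3 : ∑ γ, walsh (fun v => ∑ w, k w * f (v + w)) γ ^ 2
      ≤ M ^ 2 * ∑ γ, walsh k γ ^ 2 := by
    rw [Finset.mul_sum]
    refine Finset.sum_le_sum fun γ _ => ?_
    rw [walsh_conv, mul_pow, mul_comm]
    have : walsh f γ ^ 2 ≤ M ^ 2 := by
      rw [← sq_abs]; exact pow_le_pow_left₀ (abs_nonneg _) (hf γ) 2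
    exact mul_le_mul_of_nonneg_right this (sq_nonneg _)
  rw [h1, h2] at h3
  have hp : (0 : ℝ) < 2 ^ n := by positivity
  refine le_of_mul_le_mul_left ?_ hp
  linarith

/-- The real-valued indicator function of a set. -/
noncomputable abbrev ind {n : ℕ} (S : Set (Vec n)) : Vec n → ℝ :=
  Set.indicator S (fun _ => (1 : ℝ))

lemma ind_nonneg {n : ℕ} (S : Set (Vec n)) (x : Vec n) : 0 ≤ ind S x :=
  Set.indicator_nonneg (fun _ _ => zero_le_one) x

lemma ind_le_one {n : ℕ} (S : Set (Vec n)) (x : Vec n) : ind S x ≤ 1 :=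
  Set.indicator_le_self' (fun _ _ => zero_le_one) x

lemma ind_mul_self {n : ℕ} (S : Set (Vec n)) (x : Vec n) : ind S x * ind S x = ind S x := by
  by_cases h : x ∈ S <;> simp [ind, h]

lemma ind_congr {n : ℕ} {S T : Set (Vec n)} {x y : Vec n} (h : x ∈ S ↔ y ∈ T) :
    ind S x = ind T y := by
  classical
  simp only [ind, Set.indicator_apply, h]

lemma sum_ind {n : ℕ} (S : Set (Vec n)) : ∑ x, ind S x = Nat.card S := by
  classical
  rw [Nat.card_eq_fintype_card, Fintype.card_subtype]
  simp [ind, Set.indicator_apply]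

lemma sum_coset {n : ℕ} (V : Submodule (ZMod 2) (Vec n)) (a : Vec n) (F : Vec n → ℝ) :
    ∑ x, ind (coset a V) x * F x = ∑ v, ind (V : Set (Vec n)) v * F (a + v) := by
  rw [← Equiv.sum_comp (Equiv.addLeft a)]
  refine Finset.sum_congr rfl fun v _ => ?_
  rw [Equiv.coe_addLeft, ind_congr (T := (V : Set (Vec n))) (y := v) (by simp [coset])]

lemma sum_ind_coset {n : ℕ} (V : Submodule (ZMod 2) (Vec n)) (a : Vec n) :
    ∑ x, ind (coset a V) x = Nat.card V := by
  have := sum_coset V a (fun _ => 1)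
  simp only [mul_one] at this
  rw [this, sum_ind]
  rfl

lemma card_submodule_pos {n : ℕ} (V : Submodule (ZMod 2) (Vec n)) : (0 : ℝ) < Nat.card V := by
  exact_mod_cast Nat.card_pos

lemma sum_ind_inter_coset {n : ℕ} (V : Submodule (ZMod 2) (Vec n)) (E π : Set (Vec n)) :
    ∑ x, ind (E ∩ π) x = muOn V π E * Nat.card V := by
  rw [sum_ind, muOn, div_mul_cancel₀ _ (card_submodule_pos V).ne']

lemma ind_inter_eq_mul {n : ℕ} (S T : Set (Vec n)) (x : Vec n) :
    ind (S ∩ T) x = ind T x * ind S x := by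
  by_cases h : x ∈ S <;> by_cases h' : x ∈ T <;> simp [ind, h, h']

lemma muOn_nonneg {n : ℕ} (V : Submodule (ZMod 2) (Vec n)) (π S : Set (Vec n)) :
    0 ≤ muOn V π S := by unfold muOn; positivity

lemma muOn_coset_le_one {n : ℕ} (V : Submodule (ZMod 2) (Vec n)) (a : Vec n)
    (S : Set (Vec n)) : muOn V (coset a V) S ≤ 1 := by
  have h : ∑ x, ind (S ∩ coset a V) x ≤ ∑ x, ind (coset a V) x := by
    refine Finset.sum_le_sum fun x _ => ?_
    rw [ind_inter_eq_mul]
    exact mul_le_of_le_one_right (ind_nonneg _ _) (ind_le_one _ _)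
  rw [sum_ind_inter_coset, sum_ind_coset] at h
  have := card_submodule_pos V
  nlinarith

/-- The indicator of `E ∩ (a + V)` with its mean on the coset `a + V` removed. -/
noncomputable def balanced {n : ℕ} (V : Submodule (ZMod 2) (Vec n)) (a : Vec n)
    (E : Set (Vec n)) (x : Vec n) : ℝ :=
  ind (E ∩ coset a V) x - muOn V (coset a V) E * ind (coset a V) x

lemma walsh_ind_inter_coset {n : ℕ} (V : Submodule (ZMod 2) (Vec n)) (a : Vec n)
    (E : Set (Vec n)) (γ : Vec n) :
    walsh (ind (E ∩ coset a V)) γ = sgn (dot γ a) * (fourierOn V E a γ * Nat.card V) := by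
  rw [fourierOn, div_mul_cancel₀ _ (card_submodule_pos V).ne', walsh, Finset.mul_sum]
  simp_rw [ind_inter_eq_mul, mul_assoc]
  rw [sum_coset]
  refine Finset.sum_congr rfl fun v _ => ?_
  rw [sgn_dot_add]
  by_cases h : v ∈ V <;> simp [ind, h]
  ring

lemma walsh_ind_coset_eq_zero {n : ℕ} (V : Submodule (ZMod 2) (Vec n)) (a : Vec n) (γ : Vec n)
    (h : ∃ v ∈ V, dot γ v ≠ 0) : walsh (ind (coset a V)) γ = 0 := by
  obtain ⟨v, hv, hd⟩ := h
  have := Equiv.sum_comp (Equiv.addRight v) (fun x => ind (coset a V) x * sgn (dot γ x))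
  have hc : ∀ x, ind (coset a V) (x + v) = ind (coset a V) x := by
    intro x
    have : x + v - a ∈ V ↔ x - a ∈ V := by
      rw [show x + v - a = (x - a) + v by abel]
      exact V.add_mem_iff_left hv
    exact ind_congr this
  simp only [Equiv.coe_addRight, sgn_dot_add, sgn_eq_neg_one hd, hc] at this
  simp only [mul_neg, mul_one, Finset.sum_neg_distrib] at this
  unfold walsh
  linarith

lemma abs_walsh_balanced_le {n : ℕ} (V : Submodule (ZMod 2) (Vec n)) (a : Vec n)
    (E : Set (Vec n)) (δ : ℝ) (hδ : 0 ≤ δ)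
    (hf : ∀ γ : Vec n, (∃ v ∈ V, dot γ v ≠ 0) → |fourierOn V E a γ| ≤ δ) (γ : Vec n) :
    |walsh (balanced V a E) γ| ≤ δ * Nat.card V := by
  have hN := card_submodule_pos V
  have hw : walsh (balanced V a E) γ
      = walsh (ind (E ∩ coset a V)) γ - muOn V (coset a V) E * walsh (ind (coset a V)) γ := by
    simp only [walsh, balanced, sub_mul, Finset.sum_sub_distrib, Finset.mul_sum, mul_assoc]
  by_cases h : ∃ v ∈ V, dot γ v ≠ 0
  · rw [hw, walsh_ind_coset_eq_zero V a γ h, walsh_ind_inter_coset, mul_zero, sub_zero, abs_mul,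
      abs_sgn, one_mul, abs_mul, abs_of_pos hN]
    exact mul_le_mul_of_nonneg_right (hf γ h) hN.le
  · push Not at h
    have hs : ∀ x, ind (coset a V) x * sgn (dot γ x) = ind (coset a V) x * sgn (dot γ a) := by
      intro x
      by_cases hx : x ∈ coset a V
      · have h1 := sgn_dot_add γ a (x - a)
        rw [h _ hx, add_sub_cancel] at h1
        rw [h1]; simp [sgn]
      · simp [ind, hx]
    have h0 : walsh (balanced V a E) γ = 0 := by
      rw [hw]
      have h1 : walsh (ind (coset a V)) γ = Nat.card V * sgn (dot γ a) := by
        simp only [walsh, hs]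
        rw [← Finset.sum_mul, sum_ind_coset]
      have h2 : walsh (ind (E ∩ coset a V)) γ
          = muOn V (coset a V) E * Nat.card V * sgn (dot γ a) := by
        rw [← sum_ind_inter_coset, Finset.sum_mul, walsh]
        refine Finset.sum_congr rfl fun x _ => ?_
        rw [ind_inter_eq_mul]
        linear_combination (ind E x) * hs x
      rw [h1, h2]; ring
    rw [h0, abs_zero]; positivity

lemma add_mem_coset {n : ℕ} {V : Submodule (ZMod 2) (Vec n)} {a b c x y : Vec n}
    (h : a + b + c = 0) (hx : x ∈ coset a V) (hy : y ∈ coset b V) : x + y ∈ coset c V := by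
  have hc : c = a + b := by
    rw [← sub_eq_zero, ZModModule.sub_eq_add, ← h]; abel
  have : x + y - c = (x - a) + (y - b) := by rw [hc]; abel
  change x + y - c ∈ V
  rw [this]
  exact V.add_mem hx hy

lemma ind_coset_of_mem_add {n : ℕ} {V : Submodule (ZMod 2) (Vec n)} {a b c x y : Vec n}
    (h : a + b + c = 0) (hx : x ∈ coset a V) (hy : y ∈ coset b V) : ind (coset c V) (x + y) = 1 := by
  simp [ind, add_mem_coset h hx hy]

/-- The number of `z ∈ C` with `x + z ∈ B` and `y + z ∈ A`. -/
noncomputable def bowtieCount {n : ℕ} (A B C : Set (Vec n)) (x y : Vec n) : ℝ :=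
  ∑ z, ind C z * ind B (x + z) * ind A (y + z)

lemma bowtieCount_nonneg {n : ℕ} (A B C : Set (Vec n)) (x y : Vec n) :
    0 ≤ bowtieCount A B C x y :=
  Finset.sum_nonneg fun _ _ => mul_nonneg (mul_nonneg (ind_nonneg _ _) (ind_nonneg _ _))
    (ind_nonneg _ _)

lemma bowtieCount_le {n : ℕ} (A B C : Set (Vec n)) (x y : Vec n) :
    bowtieCount A B C x y ≤ ∑ z, ind C z := by
  refine Finset.sum_le_sum fun z _ => ?_
  have h1 : ind C z * ind B (x + z) ≤ ind C z :=
    mul_le_of_le_one_right (ind_nonneg _ _) (ind_le_one _ _)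
  exact (mul_le_of_le_one_right (mul_nonneg (ind_nonneg _ _) (ind_nonneg _ _))
    (ind_le_one _ _)).trans h1

lemma bowtieCount_sub_eq {n : ℕ} (V : Submodule (ZMod 2) (Vec n)) {a1 a2 a3 : Vec n}
    (ha : a1 + a2 + a3 = 0) (E1 E2 E3 : Set (Vec n)) {x y : Vec n}
    (hx : x ∈ coset a1 V) (hy : y ∈ coset a2 V) :
    bowtieCount (E1 ∩ coset a1 V) (E2 ∩ coset a2 V) (E3 ∩ coset a3 V) x y
        - muOn V (coset a1 V) E1 * muOn V (coset a2 V) E2 * ∑ z, ind (E3 ∩ coset a3 V) z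
      = ∑ z, ind (E3 ∩ coset a3 V) z * ind (E2 ∩ coset a2 V) (x + z) * balanced V a1 E1 (y + z)
        + muOn V (coset a1 V) E1 *
          ∑ z, ind (E3 ∩ coset a3 V) z * balanced V a2 E2 (x + z) := by
  rw [bowtieCount, Finset.mul_sum, Finset.mul_sum, ← Finset.sum_sub_distrib,
    ← Finset.sum_add_distrib]
  refine Finset.sum_congr rfl fun z _ => ?_
  by_cases hz : z ∈ E3 ∩ coset a3 V
  · have h1 : ind (coset a1 V) (y + z) = 1 :=
      ind_coset_of_mem_add (by rw [← ha]; abel) hy hz.2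
    have h2 : ind (coset a2 V) (x + z) = 1 :=
      ind_coset_of_mem_add (by rw [← ha]; abel) hx hz.2
    rw [balanced, balanced, h1, h2]
    ring
  · simp [ind, hz]

lemma sum_bowtieCount_sub_sq_le {n : ℕ} (V : Submodule (ZMod 2) (Vec n)) {a1 a2 a3 : Vec n}
    (ha : a1 + a2 + a3 = 0) (E1 E2 E3 : Set (Vec n)) {δ : ℝ} (hδ0 : 0 ≤ δ)
    (hf1 : ∀ γ : Vec n, (∃ v ∈ V, dot γ v ≠ 0) → |fourierOn V E1 a1 γ| ≤ δ)
    (hf2 : ∀ γ : Vec n, (∃ v ∈ V, dot γ v ≠ 0) → |fourierOn V E2 a2 γ| ≤ δ) :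
    ∑ x, ∑ y, ind (coset a1 V) x * ind (coset a2 V) y *
        (bowtieCount (E1 ∩ coset a1 V) (E2 ∩ coset a2 V) (E3 ∩ coset a3 V) x y
          - muOn V (coset a1 V) E1 * muOn V (coset a2 V) E2 * ∑ z, ind (E3 ∩ coset a3 V) z) ^ 2
      ≤ 4 * (Nat.card V : ℝ) ^ 3 * δ ^ 2 * ∑ z, ind (E3 ∩ coset a3 V) z := by
  set N : ℝ := (Nat.card V : ℝ)
  set H := ∑ z, ind (E3 ∩ coset a3 V) z
  set P : Vec n → Vec n → ℝ := fun x y => ∑ z, ind (E3 ∩ coset a3 V) z *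
    ind (E2 ∩ coset a2 V) (x + z) * balanced V a1 E1 (y + z)
  set R : Vec n → ℝ := fun x => ∑ z, ind (E3 ∩ coset a3 V) z * balanced V a2 E2 (x + z)
  have hsumR : ∑ x, R x ^ 2 ≤ (δ * N) ^ 2 * H := by
    refine (sum_conv_sq_le _ _ _ (abs_walsh_balanced_le V a2 E2 δ hδ0 hf2)).trans_eq ?_
    congr 1
    exact Finset.sum_congr rfl fun z _ => by rw [sq, ind_mul_self]
  have hsumP : ∀ x, ∑ y, P x y ^ 2 ≤ (δ * N) ^ 2 * H := by
    intro x
    refine (sum_conv_sq_le _ _ _ (abs_walsh_balanced_le V a1 E1 δ hδ0 hf1)).trans ?_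
    refine mul_le_mul_of_nonneg_left (Finset.sum_le_sum fun z _ => ?_) (sq_nonneg _)
    rw [mul_pow, sq, sq, ind_mul_self, ind_mul_self]
    exact mul_le_of_le_one_right (ind_nonneg _ _) (ind_le_one _ _)
  have hpt : ∀ x y, ind (coset a1 V) x * ind (coset a2 V) y *
      (bowtieCount (E1 ∩ coset a1 V) (E2 ∩ coset a2 V) (E3 ∩ coset a3 V) x y
        - muOn V (coset a1 V) E1 * muOn V (coset a2 V) E2 * H) ^ 2
      ≤ 2 * (ind (coset a1 V) x * P x y ^ 2) + 2 * (ind (coset a2 V) y * R x ^ 2) := by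
    intro x y
    have hp1 := mul_nonneg (ind_nonneg (coset a1 V) x) (sq_nonneg (P x y))
    have hp2 := mul_nonneg (ind_nonneg (coset a2 V) y) (sq_nonneg (R x))
    by_cases hx : x ∈ coset a1 V
    · by_cases hy : y ∈ coset a2 V
      · rw [bowtieCount_sub_eq V ha E1 E2 E3 hx hy]
        have h1 : ind (coset a1 V) x = 1 := by simp [ind, hx]
        have h2 : ind (coset a2 V) y = 1 := by simp [ind, hy]
        have hm0 := muOn_nonneg V (coset a1 V) E1
        have hm1 := muOn_coset_le_one V a1 E1
        change _ * (P x y + muOn V (coset a1 V) E1 * R x) ^ 2 ≤ _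
        rw [h1, h2]
        have hmR : (muOn V (coset a1 V) E1 * R x) ^ 2 ≤ R x ^ 2 := by
          rw [mul_pow]
          exact mul_le_of_le_one_left (sq_nonneg _) (pow_le_one₀ hm0 hm1)
        nlinarith [sq_nonneg (P x y - muOn V (coset a1 V) E1 * R x)]
      · have h2 : ind (coset a2 V) y = 0 := by simp [ind, hy]
        rw [h2] at hp2 ⊢
        linarith
    · have h1 : ind (coset a1 V) x = 0 := by simp [ind, hx]
      rw [h1] at hp1 ⊢
      linarith
  have h1 : ∑ x, ∑ y, ind (coset a1 V) x * P x y ^ 2 ≤ N * ((δ * N) ^ 2 * H) := by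
    rw [show N = ∑ x, ind (coset a1 V) x from (sum_ind_coset V a1).symm, Finset.sum_mul]
    refine Finset.sum_le_sum fun x _ => ?_
    rw [← Finset.mul_sum, sum_ind_coset]
    exact mul_le_mul_of_nonneg_left (hsumP x) (ind_nonneg _ _)
  have h2 : ∑ x, ∑ y, ind (coset a2 V) y * R x ^ 2 ≤ N * ((δ * N) ^ 2 * H) := by
    simp_rw [← Finset.sum_mul]
    rw [← Finset.mul_sum, sum_ind_coset]
    exact mul_le_mul_of_nonneg_left hsumR (Nat.cast_nonneg _)
  calc _ ≤ ∑ x, ∑ y, (2 * (ind (coset a1 V) x * P x y ^ 2)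
        + 2 * (ind (coset a2 V) y * R x ^ 2)) :=
        Finset.sum_le_sum fun x _ => Finset.sum_le_sum fun y _ => hpt x y
    _ = 2 * ∑ x, ∑ y, ind (coset a1 V) x * P x y ^ 2
        + 2 * ∑ x, ∑ y, ind (coset a2 V) y * R x ^ 2 := by
        simp only [Finset.sum_add_distrib, Finset.mul_sum]
    _ ≤ 2 * (N * ((δ * N) ^ 2 * H)) + 2 * (N * ((δ * N) ^ 2 * H)) := by gcongr
    _ = _ := by ring

lemma sum_sum_weighted_sq_le {n : ℕ} (p q : Vec n → ℝ) (hp : ∀ x, 0 ≤ p x) (hq : ∀ x, 0 ≤ q x)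
    (D : Vec n → Vec n → ℝ) :
    (∑ x, ∑ y, p x * q y * |D x y|) ^ 2
      ≤ ((∑ x, p x) * ∑ y, q y) * ∑ x, ∑ y, p x * q y * D x y ^ 2 := by
  rw [Finset.sum_mul_sum]
  simp only [← Fintype.sum_prod_type']
  refine Finset.sum_sq_le_sum_mul_sum_of_sq_le_mul _
    (fun i _ => mul_nonneg (hp _) (hq _))
    (fun i _ => mul_nonneg (mul_nonneg (hp _) (hq _)) (sq_nonneg _)) fun i _ => ?_
  rw [mul_pow, sq_abs]
  exact le_of_eq (by ring)

lemma sum_abs_bowtieCount_sub_le {n : ℕ} (V : Submodule (ZMod 2) (Vec n)) {a1 a2 a3 : Vec n}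
    (ha : a1 + a2 + a3 = 0) (E1 E2 E3 : Set (Vec n)) {δ : ℝ} (hδ0 : 0 ≤ δ)
    (hf1 : ∀ γ : Vec n, (∃ v ∈ V, dot γ v ≠ 0) → |fourierOn V E1 a1 γ| ≤ δ)
    (hf2 : ∀ γ : Vec n, (∃ v ∈ V, dot γ v ≠ 0) → |fourierOn V E2 a2 γ| ≤ δ)
    (hμ : 4 * δ ≤ muOn V (coset a3 V) E3) :
    ∑ x, ∑ y, ind (coset a1 V) x * ind (coset a2 V) y *
        |bowtieCount (E1 ∩ coset a1 V) (E2 ∩ coset a2 V) (E3 ∩ coset a3 V) x y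
          - muOn V (coset a1 V) E1 * muOn V (coset a2 V) E2 * ∑ z, ind (E3 ∩ coset a3 V) z|
      ≤ √δ * (Nat.card V : ℝ) ^ 2 * ∑ z, ind (E3 ∩ coset a3 V) z := by
  have hN := card_submodule_pos V
  have hvar := sum_bowtieCount_sub_sq_le V ha E1 E2 E3 hδ0 hf1 hf2
  have hcs := sum_sum_weighted_sq_le (ind (coset a1 V)) (ind (coset a2 V)) (ind_nonneg _)
    (ind_nonneg _) fun x y =>
      bowtieCount (E1 ∩ coset a1 V) (E2 ∩ coset a2 V) (E3 ∩ coset a3 V) x y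
        - muOn V (coset a1 V) E1 * muOn V (coset a2 V) E2 * ∑ z, ind (E3 ∩ coset a3 V) z
  rw [sum_ind_coset, sum_ind_coset] at hcs
  have hH : 4 * δ * Nat.card V ≤ ∑ z, ind (E3 ∩ coset a3 V) z := by
    rw [sum_ind_inter_coset]
    exact mul_le_mul_of_nonneg_right hμ hN.le
  have hH0 : 0 ≤ ∑ z, ind (E3 ∩ coset a3 V) z := Finset.sum_nonneg fun _ _ => ind_nonneg _ _
  set N : ℝ := (Nat.card V : ℝ)
  set H := ∑ z, ind (E3 ∩ coset a3 V) z
  refine le_of_sq_le_sq (hcs.trans ?_) (by positivity)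
  calc N * N * _ ≤ N * N * (4 * N ^ 3 * δ ^ 2 * H) := by gcongr
    _ = δ * N ^ 4 * H * (4 * δ * N) := by ring
    _ ≤ δ * N ^ 4 * H * H := by gcongr
    _ = (√δ * N ^ 2 * H) ^ 2 := by
      rw [mul_pow, mul_pow, Real.sq_sqrt hδ0]; ring

lemma sum_edges_le {n : ℕ} (V : Submodule (ZMod 2) (Vec n)) {a1 a2 a3 : Vec n}
    (ha : a1 + a2 + a3 = 0) (E1 E2 E3 : Set (Vec n)) {δ : ℝ} (hδ0 : 0 ≤ δ)
    (hf3 : ∀ γ : Vec n, (∃ v ∈ V, dot γ v ≠ 0) → |fourierOn V E3 a3 γ| ≤ δ) :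
    ∑ x, ∑ y, ind (E1 ∩ coset a1 V) x * ind (E2 ∩ coset a2 V) y * ind (E3 ∩ coset a3 V) (x + y)
      ≤ (Nat.card V : ℝ) ^ 2 * (muOn V (coset a1 V) E1 * muOn V (coset a2 V) E2 *
          muOn V (coset a3 V) E3 + δ) := by
  have hN := card_submodule_pos V
  have hconv := sum_conv_sq_le (ind (E2 ∩ coset a2 V)) _ _
    (abs_walsh_balanced_le V a3 E3 δ hδ0 hf3)
  have hsq : ∀ S : Set (Vec n), ∑ x, ind S x ^ 2 = ∑ x, ind S x := fun S =>
    Finset.sum_congr rfl fun x _ => by rw [sq, ind_mul_self]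
  have hle : ∀ (a : Vec n) (E : Set (Vec n)), ∑ x, ind (E ∩ coset a V) x ≤ Nat.card V := by
    intro a E
    rw [sum_ind_inter_coset]
    exact mul_le_of_le_one_left hN.le (muOn_coset_le_one V a E)
  set T : Vec n → ℝ := fun x => ∑ y, ind (E2 ∩ coset a2 V) y * balanced V a3 E3 (x + y)
  have hcs : (∑ x, ind (E1 ∩ coset a1 V) x * T x) ^ 2
      ≤ (∑ x, ind (E1 ∩ coset a1 V) x ^ 2) * ∑ x, T x ^ 2 := Finset.sum_mul_sq_le_sq_mul_sq _ _ _
  have herr : ∑ x, ind (E1 ∩ coset a1 V) x * T x ≤ δ * (Nat.card V : ℝ) ^ 2 := by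
    rw [hsq] at hconv hcs
    refine le_of_sq_le_sq (hcs.trans ?_) (by positivity)
    have h2 : ∑ x, T x ^ 2 ≤ (δ * Nat.card V) ^ 2 * Nat.card V :=
      hconv.trans (mul_le_mul_of_nonneg_left (hle a2 E2) (sq_nonneg _))
    calc _ ≤ (Nat.card V : ℝ) * ((δ * Nat.card V) ^ 2 * Nat.card V) :=
          mul_le_mul (hle a1 E1) h2 (Finset.sum_nonneg fun _ _ => sq_nonneg _) hN.le
      _ = _ := by ring
  have hpt : ∀ x y, ind (E1 ∩ coset a1 V) x * ind (E2 ∩ coset a2 V) y *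
      ind (E3 ∩ coset a3 V) (x + y)
      = muOn V (coset a3 V) E3 * (ind (E1 ∩ coset a1 V) x * ind (E2 ∩ coset a2 V) y)
        + ind (E1 ∩ coset a1 V) x * (ind (E2 ∩ coset a2 V) y * balanced V a3 E3 (x + y)) := by
    intro x y
    by_cases hx : x ∈ E1 ∩ coset a1 V
    · by_cases hy : y ∈ E2 ∩ coset a2 V
      · rw [balanced, ind_coset_of_mem_add ha hx.2 hy.2]; ring
      · simp [ind, hy]
    · simp [ind, hx]
  simp_rw [hpt, Finset.sum_add_distrib, ← Finset.mul_sum]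
  rw [← Finset.sum_mul, sum_ind_inter_coset, sum_ind_inter_coset]
  linarith

lemma card_bowtie_le {n : ℕ} (V : Submodule (ZMod 2) (Vec n)) (a1 a2 a3 : Vec n)
    (E1 E2 E3 : Set (Vec n)) (z z' : Vec n) :
    (Nat.card {e : Vec n × Vec n //
        isEdge V a1 a2 a3 E1 E2 E3 e.1 e.2 ∧ oneZ V a1 a2 E1 E2 z e ∧
        oneZ V a1 a2 E1 E2 z' e} : ℝ)
      ≤ ∑ x, ∑ y, ind (E1 ∩ coset a1 V) x * ind (E2 ∩ coset a2 V) y *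
          ind (E3 ∩ coset a3 V) (x + y) *
          (ind (E2 ∩ coset a2 V) (x + z) * ind (E1 ∩ coset a1 V) (y + z)) *
          (ind (E2 ∩ coset a2 V) (x + z') * ind (E1 ∩ coset a1 V) (y + z')) := by
  classical
  rw [Nat.card_eq_fintype_card, Fintype.card_subtype, ← Fintype.sum_prod_type', Finset.card_filter]
  push_cast
  refine Finset.sum_le_sum fun e _ => ?_
  split_ifs with h
  · obtain ⟨⟨h1, h2, h3⟩, ⟨h4, h5, -⟩, ⟨h6, h7, -⟩⟩ := h
    simp only [ind, Set.indicator_of_mem h1, Set.indicator_of_mem h2, Set.indicator_of_mem h3,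
      Set.indicator_of_mem h4, Set.indicator_of_mem h5, Set.indicator_of_mem h6,
      Set.indicator_of_mem h7]
    norm_num
  · repeat' apply mul_nonneg
    all_goals exact ind_nonneg _ _

lemma sum_comm_four {α : Type*} [Fintype α] (G : α → α → α → α → ℝ) :
    ∑ z, ∑ z', ∑ x, ∑ y, G z z' x y = ∑ x, ∑ y, ∑ z, ∑ z', G z z' x y := by
  have h := Finset.sum_comm (s := Finset.univ) (t := Finset.univ)
    (f := fun p q : α × α => G p.1 p.2 q.1 q.2)
  simpa only [Fintype.sum_prod_type] using h

lemma sum_card_bowtie_le {n : ℕ} (V : Submodule (ZMod 2) (Vec n)) (a1 a2 a3 : Vec n)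
    (E1 E2 E3 : Set (Vec n)) :
    ∑ z : Vec n, ∑ z' : Vec n, ind (E3 ∩ coset a3 V) z * ind (E3 ∩ coset a3 V) z' *
        (Nat.card {e : Vec n × Vec n //
          isEdge V a1 a2 a3 E1 E2 E3 e.1 e.2 ∧ oneZ V a1 a2 E1 E2 z e ∧
          oneZ V a1 a2 E1 E2 z' e} : ℝ)
      ≤ ∑ x, ∑ y, ind (E1 ∩ coset a1 V) x * ind (E2 ∩ coset a2 V) y *
          ind (E3 ∩ coset a3 V) (x + y) *
          bowtieCount (E1 ∩ coset a1 V) (E2 ∩ coset a2 V) (E3 ∩ coset a3 V) x y ^ 2 := by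
  refine (Finset.sum_le_sum fun z _ => Finset.sum_le_sum fun z' _ =>
    mul_le_mul_of_nonneg_left (card_bowtie_le V a1 a2 a3 E1 E2 E3 z z')
      (mul_nonneg (ind_nonneg _ _) (ind_nonneg _ _))).trans_eq ?_
  simp only [bowtieCount, sq, Finset.sum_mul_sum]
  simp only [Finset.mul_sum]
  rw [sum_comm_four]
  refine Finset.sum_congr rfl fun x _ => Finset.sum_congr rfl fun y _ =>
    Finset.sum_congr rfl fun z _ => Finset.sum_congr rfl fun z' _ => ?_
  ring

lemma sum_edges_mul_bowtieCount_sq_le {n : ℕ} (V : Submodule (ZMod 2) (Vec n))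
    {a1 a2 a3 : Vec n} (ha : a1 + a2 + a3 = 0) (E1 E2 E3 : Set (Vec n)) {δ : ℝ} (hδ0 : 0 ≤ δ)
    (hf1 : ∀ γ : Vec n, (∃ v ∈ V, dot γ v ≠ 0) → |fourierOn V E1 a1 γ| ≤ δ)
    (hf2 : ∀ γ : Vec n, (∃ v ∈ V, dot γ v ≠ 0) → |fourierOn V E2 a2 γ| ≤ δ)
    (hf3 : ∀ γ : Vec n, (∃ v ∈ V, dot γ v ≠ 0) → |fourierOn V E3 a3 γ| ≤ δ)
    (hμ : 4 * δ ≤ muOn V (coset a3 V) E3) :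
    ∑ x, ∑ y, ind (E1 ∩ coset a1 V) x * ind (E2 ∩ coset a2 V) y *
          ind (E3 ∩ coset a3 V) (x + y) *
          bowtieCount (E1 ∩ coset a1 V) (E2 ∩ coset a2 V) (E3 ∩ coset a3 V) x y ^ 2
      ≤ (∑ z, ind (E3 ∩ coset a3 V) z) ^ 2 * ((Nat.card V : ℝ) ^ 2 *
          (muOn V (coset a1 V) E1 ^ 3 * muOn V (coset a2 V) E2 ^ 3 * muOn V (coset a3 V) E3
            + δ + 2 * √δ)) := by
  have hm10 := muOn_nonneg V (coset a1 V) E1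
  have hm20 := muOn_nonneg V (coset a2 V) E2
  have hm11 := muOn_coset_le_one V a1 E1
  have hm21 := muOn_coset_le_one V a2 E2
  have habs := sum_abs_bowtieCount_sub_le V ha E1 E2 E3 hδ0 hf1 hf2 hμ
  have hedge := sum_edges_le V ha E1 E2 E3 hδ0 hf3
  have hH0 : 0 ≤ ∑ z, ind (E3 ∩ coset a3 V) z := Finset.sum_nonneg fun _ _ => ind_nonneg _ _
  have hFle := bowtieCount_le (E1 ∩ coset a1 V) (E2 ∩ coset a2 V) (E3 ∩ coset a3 V)
  have hF0 := bowtieCount_nonneg (E1 ∩ coset a1 V) (E2 ∩ coset a2 V) (E3 ∩ coset a3 V)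
  set F := bowtieCount (E1 ∩ coset a1 V) (E2 ∩ coset a2 V) (E3 ∩ coset a3 V)
  set N : ℝ := (Nat.card V : ℝ)
  set H := ∑ z, ind (E3 ∩ coset a3 V) z
  set m1 := muOn V (coset a1 V) E1
  set m2 := muOn V (coset a2 V) E2
  set m3 := muOn V (coset a3 V) E3
  have hm0 : 0 ≤ m1 * m2 := mul_nonneg hm10 hm20
  have hm1 : m1 * m2 ≤ 1 := mul_le_one₀ hm11 hm20 hm21
  have hpt : ∀ x y, ind (E1 ∩ coset a1 V) x * ind (E2 ∩ coset a2 V) y *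
      ind (E3 ∩ coset a3 V) (x + y) * F x y ^ 2
      ≤ (m1 * m2 * H) ^ 2 * (ind (E1 ∩ coset a1 V) x * ind (E2 ∩ coset a2 V) y *
          ind (E3 ∩ coset a3 V) (x + y))
        + 2 * H * (ind (coset a1 V) x * ind (coset a2 V) y * |F x y - m1 * m2 * H|) := by
    intro x y
    set w := ind (E1 ∩ coset a1 V) x * ind (E2 ∩ coset a2 V) y * ind (E3 ∩ coset a3 V) (x + y)
    have hw0 : 0 ≤ w := mul_nonneg (mul_nonneg (ind_nonneg _ _) (ind_nonneg _ _)) (ind_nonneg _ _)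
    have hwle : w ≤ ind (coset a1 V) x * ind (coset a2 V) y := by
      refine (mul_le_of_le_one_right (mul_nonneg (ind_nonneg _ _) (ind_nonneg _ _))
        (ind_le_one _ _)).trans ?_
      refine mul_le_mul ?_ ?_ (ind_nonneg _ _) (ind_nonneg _ _) <;>
      · rw [ind_inter_eq_mul]
        exact mul_le_of_le_one_right (ind_nonneg _ _) (ind_le_one _ _)
    have hmH0 : 0 ≤ m1 * m2 * H := mul_nonneg hm0 hH0
    have hmH : m1 * m2 * H ≤ H := mul_le_of_le_one_left hH0 hm1
    have hsq : F x y ^ 2 ≤ (m1 * m2 * H) ^ 2 + 2 * H * |F x y - m1 * m2 * H| := by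
      have h1 : F x y ^ 2 - (m1 * m2 * H) ^ 2
          = (F x y + m1 * m2 * H) * (F x y - m1 * m2 * H) := by ring
      have h2 : (F x y + m1 * m2 * H) * (F x y - m1 * m2 * H)
          ≤ (F x y + m1 * m2 * H) * |F x y - m1 * m2 * H| :=
        mul_le_mul_of_nonneg_left (le_abs_self _) (add_nonneg (hF0 x y) hmH0)
      have h3 : (F x y + m1 * m2 * H) * |F x y - m1 * m2 * H|
          ≤ 2 * H * |F x y - m1 * m2 * H| :=
        mul_le_mul_of_nonneg_right (by linarith [hFle x y]) (abs_nonneg _)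
      linarith
    have h4 := mul_le_mul_of_nonneg_left hsq hw0
    have h5 : w * |F x y - m1 * m2 * H|
        ≤ ind (coset a1 V) x * ind (coset a2 V) y * |F x y - m1 * m2 * H| :=
      mul_le_mul_of_nonneg_right hwle (abs_nonneg _)
    have h6 := mul_le_mul_of_nonneg_left h5 (mul_nonneg zero_le_two hH0)
    linarith
  calc _ ≤ ∑ x, ∑ y, _ := Finset.sum_le_sum fun x _ => Finset.sum_le_sum fun y _ => hpt x y
    _ ≤ (m1 * m2 * H) ^ 2 * (N ^ 2 * (m1 * m2 * m3 + δ)) + 2 * H * (√δ * N ^ 2 * H) := by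
      simp only [Finset.sum_add_distrib, ← Finset.mul_sum]
      gcongr
    _ = H ^ 2 * (N ^ 2 * (m1 ^ 3 * m2 ^ 3 * m3 + (m1 * m2) ^ 2 * δ + 2 * √δ)) := by ring
    _ ≤ _ := by
      gcongr
      exact mul_le_of_le_one_left hδ0 (pow_le_one₀ hm0 hm1)

lemma sum_edges_mul_bowtieCount_sq_le_trivial {n : ℕ} (V : Submodule (ZMod 2) (Vec n))
    (a1 a2 a3 : Vec n) (E1 E2 E3 : Set (Vec n)) :
    ∑ x, ∑ y, ind (E1 ∩ coset a1 V) x * ind (E2 ∩ coset a2 V) y *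
          ind (E3 ∩ coset a3 V) (x + y) *
          bowtieCount (E1 ∩ coset a1 V) (E2 ∩ coset a2 V) (E3 ∩ coset a3 V) x y ^ 2
      ≤ (∑ z, ind (E3 ∩ coset a3 V) z) ^ 2 *
          ((Nat.card V : ℝ) ^ 2 * muOn V (coset a3 V) E3) := by
  have hN := card_submodule_pos V
  have hH0 : 0 ≤ ∑ z, ind (E3 ∩ coset a3 V) z := Finset.sum_nonneg fun _ _ => ind_nonneg _ _
  have hE : (Nat.card V : ℝ) ^ 2 * muOn V (coset a3 V) E3
      = ∑ x, ∑ y, ind (coset a1 V) x * ind (E3 ∩ coset a3 V) (x + y) := by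
    have h (x : Vec n) := Equiv.sum_comp (Equiv.addLeft x) (ind (E3 ∩ coset a3 V))
    simp only [Equiv.coe_addLeft] at h
    simp_rw [← Finset.mul_sum, h]
    rw [← Finset.sum_mul, sum_ind_coset, sum_ind_inter_coset]
    ring
  rw [hE, Finset.mul_sum]
  refine Finset.sum_le_sum fun x _ => ?_
  rw [Finset.mul_sum]
  refine Finset.sum_le_sum fun y _ => ?_
  rw [mul_comm]
  refine mul_le_mul (pow_le_pow_left₀ (bowtieCount_nonneg _ _ _ _ _)
    (bowtieCount_le _ _ _ _ _) 2) ?_ (mul_nonneg (mul_nonneg (ind_nonneg _ _) (ind_nonneg _ _))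
    (ind_nonneg _ _)) (sq_nonneg _)
  refine mul_le_mul_of_nonneg_right ?_ (ind_nonneg _ _)
  refine (mul_le_of_le_one_right (ind_nonneg _ _) (ind_le_one _ _)).trans ?_
  rw [ind_inter_eq_mul]
  exact mul_le_of_le_one_right (ind_nonneg _ _) (ind_le_one _ _)

/-- ℓ₂ upper bound: `(1/|E3 ∩ π3|²) Σ_{z, z' ∈ E3 ∩ π3} #{e edge of G : 1_z(e) = 1_{z'}(e) = 1}`
is at most `|V|² (μ1³ μ2³ μ3 + 10 √δ)`. -/
theorem bowtie_l2_upper_bound {n : ℕ} (V : Submodule (ZMod 2) (Vec n))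
    (a1 a2 a3 : Vec n) (ha : a1 + a2 + a3 = 0) (E1 E2 E3 : Set (Vec n)) (δ : ℝ)
    (hδ0 : 0 ≤ δ) (hδ1 : δ ≤ 1)
    (hne : (E3 ∩ coset a3 V).Nonempty)
    (hf1 : ∀ γ : Vec n, (∃ v ∈ V, dot γ v ≠ 0) → |fourierOn V E1 a1 γ| ≤ δ)
    (hf2 : ∀ γ : Vec n, (∃ v ∈ V, dot γ v ≠ 0) → |fourierOn V E2 a2 γ| ≤ δ)
    (hf3 : ∀ γ : Vec n, (∃ v ∈ V, dot γ v ≠ 0) → |fourierOn V E3 a3 γ| ≤ δ) :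
    (1 / (Nat.card (E3 ∩ coset a3 V : Set (Vec n)) : ℝ) ^ 2) *
        ∑ z : Vec n, ∑ z' : Vec n,
          Set.indicator (E3 ∩ coset a3 V) (fun _ => (1 : ℝ)) z *
          Set.indicator (E3 ∩ coset a3 V) (fun _ => (1 : ℝ)) z' *
          (Nat.card {e : Vec n × Vec n //
              isEdge V a1 a2 a3 E1 E2 E3 e.1 e.2 ∧ oneZ V a1 a2 E1 E2 z e ∧
              oneZ V a1 a2 E1 E2 z' e} : ℝ)
      ≤ (Nat.card V : ℝ) ^ 2 *
          (muOn V (coset a1 V) E1 ^ 3 * muOn V (coset a2 V) E2 ^ 3 * muOn V (coset a3 V) E3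
            + 10 * Real.sqrt δ) := by
  have hN := card_submodule_pos V
  have hH : 0 < ∑ z, ind (E3 ∩ coset a3 V) z := by
    obtain ⟨z, hz⟩ := hne
    exact Finset.sum_pos' (fun _ _ => ind_nonneg _ _) ⟨z, Finset.mem_univ _, by simp [ind, hz]⟩
  have hδs : δ ≤ √δ := Real.le_sqrt_of_sq_le (by nlinarith)
  have hm1 := muOn_nonneg V (coset a1 V) E1
  have hm2 := muOn_nonneg V (coset a2 V) E2
  have hm3 := muOn_nonneg V (coset a3 V) E3
  have hm : 0 ≤ muOn V (coset a1 V) E1 ^ 3 * muOn V (coset a2 V) E2 ^ 3 *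
      muOn V (coset a3 V) E3 := by positivity
  rw [← sum_ind, one_div, inv_mul_le_iff₀ (by positivity)]
  refine (sum_card_bowtie_le V a1 a2 a3 E1 E2 E3).trans ?_
  by_cases hμ : 4 * δ ≤ muOn V (coset a3 V) E3
  · refine (sum_edges_mul_bowtieCount_sq_le V ha E1 E2 E3 hδ0 hf1 hf2 hf3 hμ).trans ?_
    refine mul_le_mul_of_nonneg_left (mul_le_mul_of_nonneg_left ?_ (by positivity)) (by positivity)
    linarith [Real.sqrt_nonneg δ]
  · refine (sum_edges_mul_bowtieCount_sq_le_trivial V a1 a2 a3 E1 E2 E3).trans ?_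
    gcongr
    linarith
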